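/- arXiv:2310.13903 — 11 statements merged into one kernel-verified Lean document; each statement's English description precedes it below -/
import Mathlib

section
/- Let ω = (ω_1,…,ω_n) ∈ ℝⁿ and let 𝒟 := { |A|⁻¹ : A = k_1ω_1 + ⋯ + k_nω_n ≠ 0 for some (k_1,…,k_n) ∈ ℤⁿ }. Then 𝒟 is dense in [0,+∞) if and only if there exist indices i, j ∈ {1,…,n} such that ω_j ≠ 0 and ω_i/ω_j is irrational. -/
/-- Let `𝒟 := { |A|⁻¹ : A = k₁ω₁ + ⋯ + kₙωₙ ≠ 0, (k₁,…,kₙ) ∈ ℤⁿ }`. Then `𝒟` is dense in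
`[0,+∞)` iff there exist indices `i, j` such that `ω j ≠ 0` and `ω i / ω j` is irrational. -/
theorem stmt_2 (n : ℕ) (ω : Fin n → ℝ) :
    Set.Ici (0 : ℝ) ⊆
        closure {T : ℝ | ∃ k : Fin n → ℤ, (∑ i, (k i : ℝ) * ω i) ≠ 0 ∧
          T = |∑ i, (k i : ℝ) * ω i|⁻¹}
      ↔ ∃ i j : Fin n, ω j ≠ 0 ∧ Irrational (ω i / ω j) := by
  constructor
  · intro h
    by_contra hcon
    push Not at hcon
    suffices hb : ∃ C : ℝ, 0 ≤ C ∧ ∀ k : Fin n → ℤ, (∑ i, (k i : ℝ) * ω i) ≠ 0 →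
        |∑ i, (k i : ℝ) * ω i|⁻¹ ≤ C by
      obtain ⟨C, hC, hb⟩ := hb
      have hsub : closure {T : ℝ | ∃ k : Fin n → ℤ, (∑ i, (k i : ℝ) * ω i) ≠ 0 ∧
          T = |∑ i, (k i : ℝ) * ω i|⁻¹} ⊆ Set.Iic C := by
        apply closure_minimal _ isClosed_Iic
        rintro T ⟨k, hk, rfl⟩
        exact hb k hk
      have := hsub (h (show C + 1 ∈ Set.Ici (0 : ℝ) from by simp only [Set.mem_Ici]; linarith))
      simp only [Set.mem_Iic] at this
      linarith
    by_cases hz : ∃ j, ω j ≠ 0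
    · obtain ⟨j, hj⟩ := hz
      have hq : ∀ i, ∃ q : ℚ, (q : ℝ) = ω i / ω j := by
        intro i
        have := hcon i j hj
        simpa [Irrational] using this
      choose q hq using hq
      have hN : ∃ N : ℤ, 0 < N ∧ ∀ i, ∃ m : ℤ, (N : ℝ) * ω i = m * ω j := by
        refine ⟨∏ i, ((q i).den : ℤ), Finset.prod_pos fun i _ => by exact_mod_cast (q i).pos, ?_⟩
        intro i
        obtain ⟨c, hc⟩ := Finset.dvd_prod_of_mem (fun i => ((q i).den : ℤ)) (Finset.mem_univ i)
        refine ⟨c * (q i).num, ?_⟩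
        rw [hc]
        have h1 : ω i = q i * ω j := by rw [hq]; field_simp
        have h2 : ((q i).den : ℝ) * (q i : ℝ) = (q i).num := by
          exact_mod_cast Rat.den_mul_eq_num (q i)
        rw [h1]
        push_cast
        rw [← h2]
        ring
      obtain ⟨N, hN0, hN⟩ := hN
      choose m hm using hN
      have hN0' : (0 : ℝ) < N := by exact_mod_cast hN0
      have hj' : 0 < |ω j| := abs_pos.mpr hj
      refine ⟨N / |ω j|, by positivity, fun k hk => ?_⟩
      have key : (N : ℝ) * (∑ i, (k i : ℝ) * ω i) = ((∑ i, k i * m i : ℤ) : ℝ) * ω j := by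
        push_cast
        rw [Finset.mul_sum, Finset.sum_mul]
        refine Finset.sum_congr rfl fun i _ => ?_
        rw [mul_left_comm, hm]; ring
      have hM : (∑ i, k i * m i : ℤ) ≠ 0 := by
        intro h0
        rw [h0] at key
        simp only [Int.cast_zero, zero_mul, mul_eq_zero] at key
        exact key.elim hN0'.ne' hk
      have hM1 : (1 : ℝ) ≤ |((∑ i, k i * m i : ℤ) : ℝ)| := by
        exact_mod_cast Int.one_le_abs hM
      have hab := congrArg abs key
      rw [abs_mul, abs_mul, abs_of_pos hN0'] at hab
      have hA : 0 < |∑ i, (k i : ℝ) * ω i| := abs_pos.mpr hk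
      rw [inv_eq_one_div, div_le_div_iff₀ hA hj', hab]
      gcongr
    · push Not at hz
      exact ⟨0, le_rfl, fun k hk => absurd (by simp [hz]) hk⟩
  · rintro ⟨i, j, hj, hirr⟩ T hT
    simp only [Set.mem_Ici] at hT
    have hd := dense_addSubgroupClosure_pair_iff.mpr hirr
    rw [Metric.mem_closure_iff]
    intro ε hε
    have hlt : (T + ε)⁻¹ < (T + ε / 2)⁻¹ := by
      apply inv_strictAnti₀ <;> linarith
    obtain ⟨A, hAmem, hA1, hA2⟩ := hd.exists_between hlt
    have hp : 0 < (T + ε)⁻¹ := by positivity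
    have hA0 : 0 < A := hp.trans hA1
    obtain ⟨a, b, hab⟩ := AddSubgroup.mem_closure_pair.mp hAmem
    have hs : (∑ l, (((Pi.single i a + Pi.single j b : Fin n → ℤ) l : ℤ) : ℝ) * ω l) = A := by
      rw [← hab]
      simp [add_mul, Finset.sum_add_distrib, Pi.single_apply]
    refine ⟨A⁻¹, ⟨Pi.single i a + Pi.single j b, ?_, ?_⟩, ?_⟩
    · rw [hs]; exact hA0.ne'
    · rw [hs, abs_of_pos hA0]
    · have h1 : A⁻¹ < T + ε := inv_lt_of_inv_lt₀ (by linarith) hA1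
      have h2 : T + ε / 2 < A⁻¹ := (lt_inv_comm₀ hA0 (by linarith)).mp hA2
      rw [Real.dist_eq, abs_lt]
      constructor <;> linarith
end

section
/- Let ω = (ω_1,…,ω_n) ∈ ℝⁿ and T > 0 be such that (k_1ω_1 + ⋯ + k_nω_n)·T ≠ k_{n+1} for every (k_1,…,k_{n+1}) ∈ ℤ^{n+1} with k_{n+1} ≠ 0. Then for every x_0 ∈ ℝⁿ and every t ∈ ℝ, the point Π(x_0 + tω) belongs to the closure in 𝕋ⁿ of the set { Π(x_0 + mTω) : m ∈ ℤ }. In other words, the orbit of Π(x_0) under the time-T translation x ↦ x + Π(Tω) is dense in the full orbit { Π(x_0 + tω) : t ∈ ℝ } of the linear flow. -/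
open UnitAddTorus in
lemma mF_add {n : ℕ} (k : Fin n → ℤ) (x y : UnitAddTorus (Fin n)) :
    mFourier k (x + y) = mFourier k x * mFourier k y := by
  simp only [mFourier, ContinuousMap.coe_mk, ← Finset.prod_mul_distrib]
  refine Finset.prod_congr rfl fun i _ => ?_
  simp [fourier_apply, smul_add, AddCircle.toCircle_add]

open UnitAddTorus in
lemma mF_nsmul {n : ℕ} (k : Fin n → ℤ) (x : UnitAddTorus (Fin n)) (m : ℕ) :
    mFourier k (m • x) = mFourier k x ^ m := by
  induction m with
  | zero => simp [mFourier]
  | succ m ih => rw [succ_nsmul, mF_add, ih, pow_succ]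

open UnitAddTorus in
lemma mF_norm {n : ℕ} (k : Fin n → ℤ) (x : UnitAddTorus (Fin n)) :
    ‖mFourier k x‖ = 1 := by
  simp only [mFourier, fourier_apply, ContinuousMap.coe_mk, norm_prod]
  exact Finset.prod_eq_one fun i _ => Circle.norm_coe _

open UnitAddTorus in
lemma mF_coe {n : ℕ} (k : Fin n → ℤ) (a : Fin n → ℝ) :
    mFourier k (fun i => ((a i : ℝ) : AddCircle (1 : ℝ))) =
      Complex.exp (2 * Real.pi * Complex.I * ((∑ i, (k i : ℝ) * a i : ℝ) : ℂ)) := by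
  simp only [mFourier, ContinuousMap.coe_mk, fourier_coe_apply, ← Complex.exp_sum]
  congr 1
  push_cast
  rw [Finset.mul_sum]
  refine Finset.sum_congr rfl fun i _ => ?_
  ring

open UnitAddTorus in
lemma span_bdd {n : ℕ} (p g : UnitAddTorus (Fin n))
    (h : ∀ k : Fin n → ℤ, mFourier k g = 1 → mFourier k p = 1)
    (f : C(UnitAddTorus (Fin n), ℂ))
    (hf : f ∈ Submodule.span ℂ (Set.range (mFourier (d := Fin n)))) :
    ∃ C : ℝ, ∀ N : ℕ, ‖∑ m ∈ Finset.range N, (f (p + m • g) - f (m • g))‖ ≤ C := by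
  induction hf using Submodule.span_induction with
  | mem f hf =>
    obtain ⟨k, rfl⟩ := hf
    by_cases hk : mFourier k g = 1
    · refine ⟨0, fun N => ?_⟩
      simp [mF_add, h k hk]
    · refine ⟨2 * (2 / ‖mFourier k g - 1‖), fun N => ?_⟩
      have e : ∑ m ∈ Finset.range N, (mFourier k (p + m • g) - mFourier k (m • g)) =
          (mFourier k p - 1) * ∑ m ∈ Finset.range N, mFourier k g ^ m := by
        rw [Finset.mul_sum]
        refine Finset.sum_congr rfl fun m _ => ?_
        rw [mF_add, mF_nsmul]; ring
      rw [e, geom_sum_eq hk, norm_mul, norm_div]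
      have h1 : ‖mFourier k p - 1‖ ≤ 2 := by
        refine (norm_sub_le _ _).trans ?_
        rw [mF_norm, norm_one]; norm_num
      have h2 : ‖mFourier k g ^ N - 1‖ ≤ 2 := by
        refine (norm_sub_le _ _).trans ?_
        rw [norm_pow, mF_norm, norm_one]; norm_num
      gcongr
  | zero => exact ⟨0, fun N => by simp⟩
  | add f₁ f₂ _ _ h₁ h₂ =>
    obtain ⟨C₁, h₁⟩ := h₁
    obtain ⟨C₂, h₂⟩ := h₂
    refine ⟨C₁ + C₂, fun N => ?_⟩
    refine le_trans (le_of_eq ?_) ((norm_add_le _ _).trans (add_le_add (h₁ N) (h₂ N)))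
    rw [← Finset.sum_add_distrib]
    congr 1
    refine Finset.sum_congr rfl fun m _ => ?_
    simp only [ContinuousMap.add_apply]; ring
  | smul a f _ h₁ =>
    obtain ⟨C₁, h₁⟩ := h₁
    refine ⟨‖a‖ * C₁, fun N => ?_⟩
    refine le_trans (le_of_eq ?_) (mul_le_mul_of_nonneg_left (h₁ N) (norm_nonneg a))
    rw [← norm_mul, Finset.mul_sum]
    congr 1
    refine Finset.sum_congr rfl fun m _ => ?_
    simp only [ContinuousMap.smul_apply, smul_eq_mul]; ring

open UnitAddTorus in
lemma mem_closure_of_chars {n : ℕ} (p g : UnitAddTorus (Fin n))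
    (h : ∀ k : Fin n → ℤ, mFourier k g = 1 → mFourier k p = 1) :
    p ∈ (AddSubgroup.zmultiples g).topologicalClosure := by
  by_contra hp
  set H := (AddSubgroup.zmultiples g).topologicalClosure with hH
  have hc : IsClosed (H : Set (UnitAddTorus (Fin n))) :=
    AddSubgroup.isClosed_topologicalClosure _
  have hc2 : IsClosed ((fun y => y - p) ⁻¹' (H : Set (UnitAddTorus (Fin n)))) :=
    hc.preimage (by fun_prop)
  have hg : ∀ m : ℕ, m • g ∈ H := fun m =>
    H.nsmul_mem (AddSubgroup.le_topologicalClosure _ (AddSubgroup.mem_zmultiples g)) m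
  obtain ⟨f, hf0, hf1, -⟩ := exists_continuous_zero_one_of_isClosed hc hc2 (by
    rw [Set.disjoint_left]
    intro y hy hy2
    apply hp
    have := H.sub_mem hy hy2
    simpa using this)
  let F : C(UnitAddTorus (Fin n), ℂ) := ⟨fun x => (f x : ℂ), by fun_prop⟩
  have hF : F ∈ (Submodule.span ℂ (Set.range (mFourier (d := Fin n)))).topologicalClosure := by
    rw [span_mFourier_closure_eq_top]; trivial
  obtain ⟨f', hf', hd⟩ := Metric.mem_closure_iff.1 hF (1 / 4) (by norm_num)
  obtain ⟨C, hC⟩ := span_bdd p g h f' hf'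
  have hpt : ∀ x, ‖F x - f' x‖ ≤ 1 / 4 := fun x => by
    rw [← dist_eq_norm]
    exact (ContinuousMap.dist_apply_le_dist x).trans hd.le
  obtain ⟨N, hN⟩ := exists_nat_gt (2 * C)
  have key : ‖(N : ℂ) - ∑ m ∈ Finset.range N, (f' (p + m • g) - f' (m • g))‖ ≤ N * (1 / 2) := by
    have : (N : ℂ) - ∑ m ∈ Finset.range N, (f' (p + m • g) - f' (m • g)) =
        ∑ m ∈ Finset.range N, ((F (p + m • g) - f' (p + m • g)) - (F (m • g) - f' (m • g))) := by
      have e : (N : ℂ) = ∑ m ∈ Finset.range N, (1 : ℂ) := by simp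
      rw [e, ← Finset.sum_sub_distrib]
      refine Finset.sum_congr rfl fun m _ => ?_
      have a0 : F (m • g) = 0 := by
        have := hf0 (hg m)
        simp [F, this]
      have a1 : F (p + m • g) = 1 := by
        have : f (p + m • g) = 1 := hf1 (by simpa using hg m)
        simp [F, this]
      rw [a0, a1]; ring
    rw [this]
    refine (norm_sum_le_of_le _ (f := _) (n := fun _ => (1 / 2 : ℝ)) fun m _ => ?_).trans (by simp)
    refine (norm_sub_le _ _).trans ?_
    linarith [hpt (p + m • g), hpt (m • g)]
  have h3 := norm_sub_norm_le (N : ℂ) (∑ m ∈ Finset.range N, (f' (p + m • g) - f' (m • g)))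
  rw [Complex.norm_natCast] at h3
  linarith [hC N]

/-- If `T > 0` satisfies `(k₁ω₁ + ⋯ + kₙωₙ)·T ≠ k_{n+1}` for every integer vector with
`k_{n+1} ≠ 0`, then for every `x₀ ∈ ℝⁿ` and `t ∈ ℝ`, the point `Π(x₀ + tω)` of the torus
`𝕋ⁿ = (ℝ/ℤ)ⁿ` lies in the closure of the orbit `{ Π(x₀ + mTω) : m ∈ ℤ }`. -/
theorem stmt_4 (n : ℕ) (ω : Fin n → ℝ) (T : ℝ) (hT : 0 < T)
    (hTD : ∀ (k : Fin n → ℤ) (m : ℤ), m ≠ 0 → (∑ i, (k i : ℝ) * ω i) * T ≠ (m : ℝ))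
    (x₀ : Fin n → ℝ) (t : ℝ) :
    (fun i => ((x₀ i + t * ω i : ℝ) : AddCircle (1 : ℝ))) ∈
      closure {y : Fin n → AddCircle (1 : ℝ) |
        ∃ m : ℤ, y = fun i => ((x₀ i + (m : ℝ) * T * ω i : ℝ) : AddCircle (1 : ℝ))} := by
  set g : UnitAddTorus (Fin n) := fun i => ((T * ω i : ℝ) : AddCircle (1 : ℝ)) with hg
  set p : UnitAddTorus (Fin n) := fun i => ((t * ω i : ℝ) : AddCircle (1 : ℝ)) with hp
  have hmem : p ∈ (AddSubgroup.zmultiples g).topologicalClosure := by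
    apply mem_closure_of_chars
    intro k hk
    rw [hg, mF_coe, Complex.exp_eq_one_iff] at hk
    obtain ⟨m, hm⟩ := hk
    have hs : ∀ s : ℝ, ∑ i, (k i : ℝ) * (s * ω i) = (∑ i, (k i : ℝ) * ω i) * s := fun s => by
      rw [Finset.sum_mul]
      exact Finset.sum_congr rfl fun i _ => by ring
    have hm2 : (∑ i, (k i : ℝ) * ω i) * T = (m : ℝ) := by
      rw [← hs]
      have h2 : (2 * Real.pi * Complex.I : ℂ) ≠ 0 := Complex.two_pi_I_ne_zero
      rw [mul_comm (m : ℂ)] at hm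
      exact_mod_cast mul_left_cancel₀ h2 hm
    have hm0 : m = 0 := by
      by_contra h0
      exact hTD k m h0 hm2
    have h0 : ∑ i, (k i : ℝ) * ω i = 0 := by
      rw [hm0, Int.cast_zero] at hm2
      exact (mul_eq_zero.1 hm2).resolve_right hT.ne'
    rw [hp, mF_coe, hs, h0]
    simp
  let q : UnitAddTorus (Fin n) := fun i => ((x₀ i : ℝ) : AddCircle (1 : ℝ))
  have hcont : Continuous (fun y : UnitAddTorus (Fin n) => q + y) := by fun_prop
  refine map_mem_closure hcont (x := p) hmem ?_
  rintro _ ⟨m, rfl⟩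
  refine ⟨m, ?_⟩
  funext i
  have e : (m : ℝ) * T * ω i = m • (T * ω i) := by rw [zsmul_eq_mul]; ring
  rw [e]
  rfl
end

section
/- Let H : ℝⁿ × ℝ → ℝ, (p,u) ↦ H(p,u), be of class C³ and satisfy: (H1) the Hessian ∂²H/∂p²(p,u) is positive definite for every (p,u); (H2) for every u ∈ ℝ, H(p,u)/|p| → +∞ as |p| → ∞; (H3) there are constants κ > 0 and δ > 0 with −κ ≤ ∂H/∂u(p,u) ≤ −δ < 0 for all (p,u). Let c ∈ ℝ be the (unique) real number with H(0,c) = 0 and set ω := ∂H/∂p(0,c) ∈ ℝⁿ. For ε > 0 and x_0 = (x_1^0,…,x_n^0) ∈ ℝⁿ define W^ε_{x_0}(x,t) := c + ε ∑_{i=1}^n (1 + sin(2π x_i − 2π x_i^0 − π/2 − 2π ω_i t)). Then for every x_0 ∈ ℝⁿ there exists ε_0 > 0 such that for all ε ∈ (0, ε_0] and all (x,t) ∈ ℝⁿ × [0,+∞): (i) ∂_t W^ε_{x_0}(x,t) + H(∇_x W^ε_{x_0}(x,t), W^ε_{x_0}(x,t)) ≤ 0, and (ii) W^ε_{x_0}(x,t)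 ≥ c. -/
lemma aux_taylor {n : ℕ} (g : (Fin n → ℝ) → ℝ) (hg : ContDiff ℝ 3 g) :
    ∃ K > 0, ∃ r > 0, ∀ p, ‖p‖ < r → g p - g 0 - fderiv ℝ g 0 p ≤ K * ‖p‖ ^ 2 := by
  have h1 : ContDiff ℝ 1 (fderiv ℝ g) := hg.fderiv_right (by norm_num)
  obtain ⟨K, t, ht, hL⟩ := (h1.contDiffAt (x := 0)).exists_lipschitzOnWith
  obtain ⟨r, hr, hrt⟩ := Metric.mem_nhds_iff.1 ht
  refine ⟨K + 1, by positivity, r, hr, fun p hp => ?_⟩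
  have hd : Differentiable ℝ g := hg.differentiable (by norm_num)
  have hsub : ∀ q ∈ Metric.closedBall (0 : Fin n → ℝ) ‖p‖, q ∈ t := fun q hq =>
    hrt (by rw [mem_closedBall_zero_iff] at hq; rw [mem_ball_zero_iff]; linarith)
  have key := (convex_closedBall (0 : Fin n → ℝ) ‖p‖).norm_image_sub_le_of_norm_hasFDerivWithin_le'
    (f := g) (f' := fderiv ℝ g) (φ := fderiv ℝ g 0) (C := K * ‖p‖) (x := 0) (y := p)
    (fun q _ => (hd q).hasFDerivAt.hasFDerivWithinAt)
    (fun q hq => by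
      have h := hL.dist_le_mul q (hsub q hq) 0 (hsub 0 (by simp))
      rw [dist_eq_norm, dist_zero_right] at h
      rw [mem_closedBall_zero_iff] at hq
      exact h.trans (by gcongr)) (by simp) (by simp)
  rw [sub_zero] at key
  have := (le_abs_self _).trans key
  nlinarith [sq_nonneg ‖p‖]


/-- Under assumptions (H1)-(H3) on the `C³` contact Hamiltonian `H(p,u)`, with `c` the zero
of `u ↦ H(0,u)` and `ω := ∂H/∂p(0,c)`, for every `x₀` there is `ε₀ > 0` such that for all
`ε ∈ (0,ε₀]` the function
`W^ε_{x₀}(x,t) := c + ε ∑ᵢ (1 + sin(2πxᵢ − 2πx₀ᵢ − π/2 − 2πωᵢt))`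
is a (classical) subsolution of `∂ₜW + H(∇ₓW, W) = 0` on `ℝⁿ × [0,∞)` and satisfies `W ≥ c`. -/
theorem stmt_6 (n : ℕ) (H : (Fin n → ℝ) → ℝ → ℝ)
    (hC3 : ContDiff ℝ 3 (fun pu : (Fin n → ℝ) × ℝ => H pu.1 pu.2))
    (hH1 : ∀ (p : Fin n → ℝ) (u : ℝ) (v : Fin n → ℝ), v ≠ 0 →
      0 < iteratedDeriv 2 (fun s : ℝ => H (p + s • v) u) 0)
    (hH2 : ∀ u : ℝ, Filter.Tendsto (fun p : Fin n → ℝ => H p u / ‖p‖)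
      (Filter.cocompact (Fin n → ℝ)) Filter.atTop)
    (κ δ : ℝ) (hκ : 0 < κ) (hδ : 0 < δ)
    (hH3 : ∀ (p : Fin n → ℝ) (u : ℝ), -κ ≤ deriv (H p) u ∧ deriv (H p) u ≤ -δ)
    (c : ℝ) (hc : H 0 c = 0)
    (ω : Fin n → ℝ) (hω : ∀ i, ω i = deriv (fun s : ℝ => H (Pi.single i s) c) 0)
    (x₀ : Fin n → ℝ)
    (W : ℝ → (Fin n → ℝ) → ℝ → ℝ)
    (hW : ∀ ε x t, W ε x t = c + ε * ∑ i,
      (1 + Real.sin (2 * Real.pi * x i - 2 * Real.pi * x₀ i - Real.pi / 2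
        - 2 * Real.pi * ω i * t))) :
    ∃ ε₀ > 0, ∀ ε ∈ Set.Ioc 0 ε₀, ∀ (x : Fin n → ℝ) (t : ℝ), 0 ≤ t →
      (deriv (fun s => W ε x s) t
        + H (fun j => deriv (fun y => W ε (Function.update x j y) t) (x j)) (W ε x t) ≤ 0)
      ∧ c ≤ W ε x t := by
  have hg : ContDiff ℝ 3 (fun p : Fin n → ℝ => H p c) :=
    hC3.comp (contDiff_id.prodMk contDiff_const)
  obtain ⟨K, hK, r, hr, hT⟩ := aux_taylor _ hg
  have hlin : ∀ p : Fin n → ℝ, fderiv ℝ (fun p : Fin n → ℝ => H p c) 0 p = ∑ i, ω i * p i := by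
    intro p
    have hd : DifferentiableAt ℝ (fun p : Fin n → ℝ => H p c) 0 :=
      hg.differentiable (by norm_num) 0
    have hi : ∀ i, ω i = fderiv ℝ (fun p : Fin n → ℝ => H p c) 0 (Pi.single i 1) := by
      intro i
      rw [hω i]
      have h0 : HasDerivAt (fun s : ℝ => (Pi.single i s : Fin n → ℝ)) (Pi.single i 1) 0 := by
        exact hasDerivAt_single i 0
      have hd' : HasFDerivAt (fun p : Fin n → ℝ => H p c)
        (fderiv ℝ (fun p : Fin n → ℝ => H p c) 0) (Pi.single i (0:ℝ)) := by
        rw [Pi.single_zero]; exact hd.hasFDerivAt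
      exact (hd'.comp_hasDerivAt (0:ℝ) h0).deriv
    conv_lhs => rw [pi_eq_sum_univ' p]
    rw [map_sum]
    refine Finset.sum_congr rfl fun i _ => ?_
    rw [map_smul, hi i, smul_eq_mul, mul_comm]
  have hmono : ∀ (p : Fin n → ℝ) (w : ℝ), c ≤ w → H p w - H p c ≤ -δ * (w - c) := by
    intro p w hw
    have hd : Differentiable ℝ (H p) := by
      have : ContDiff ℝ 3 (H p) := hC3.comp (contDiff_const.prodMk contDiff_id)
      exact this.differentiable (by norm_num)
    exact image_sub_le_mul_sub_of_deriv_le hd (fun u => (hH3 p u).2) hw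
  have hpi := Real.pi_pos
  refine ⟨min (r / (4 * Real.pi)) (δ / (8 * Real.pi ^ 2 * K)), by positivity, ?_⟩
  rintro ε ⟨hε, hε'⟩ x t -
  have hε1 : ε * (4 * Real.pi) ≤ r := by
    rw [← le_div_iff₀ (by positivity)]; exact hε'.trans (min_le_left _ _)
  have hε2 : ε * (8 * Real.pi ^ 2 * K) ≤ δ := by
    rw [← le_div_iff₀ (by positivity)]; exact hε'.trans (min_le_right _ _)
  set θ : Fin n → ℝ := fun i => 2 * Real.pi * x i - 2 * Real.pi * x₀ i - Real.pi / 2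
        - 2 * Real.pi * ω i * t with hθ
  set S : ℝ := ∑ i, (1 + Real.sin (θ i)) with hS
  have hterm : ∀ i, 0 ≤ 1 + Real.sin (θ i) := fun i => by linarith [Real.neg_one_le_sin (θ i)]
  have hS0 : 0 ≤ S := Finset.sum_nonneg fun i _ => hterm i
  have hWS : W ε x t = c + ε * S := hW ε x t
  have hWc : c ≤ W ε x t := by rw [hWS]; nlinarith [mul_nonneg hε.le hS0]
  refine ⟨?_, hWc⟩
  set p : Fin n → ℝ := fun j => ε * (2 * Real.pi * Real.cos (θ j)) with hp
  have hgrad : (fun j => deriv (fun y => W ε (Function.update x j y) t) (x j)) = p := by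
    funext j
    apply HasDerivAt.deriv
    simp only [hW]
    have hs : HasDerivAt (fun y => ∑ i, (1 + Real.sin (2 * Real.pi * Function.update x j y i
        - 2 * Real.pi * x₀ i - Real.pi / 2 - 2 * Real.pi * ω i * t)))
        (∑ i, if i = j then 2 * Real.pi * Real.cos (θ j) else 0) (x j) := by
      apply HasDerivAt.fun_sum
      intro i _
      by_cases hij : i = j
      · subst hij
        simp only [Function.update_self, if_true]
        have h := ((((((hasDerivAt_id (x i)).const_mul (2 * Real.pi)).sub_const
          (2 * Real.pi * x₀ i)).sub_const (Real.pi / 2)).sub_const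
          (2 * Real.pi * ω i * t)).sin).const_add 1
        refine HasDerivAt.congr_deriv h ?_
        simp only [hθ, id]; ring
      · simp only [Function.update_of_ne hij, if_neg hij]
        exact hasDerivAt_const _ _
    simpa [hp] using (hs.const_mul ε).const_add c
  have htime : deriv (fun s => W ε x s) t = -∑ i, ω i * p i := by
    apply HasDerivAt.deriv
    simp only [hW]
    have hs : HasDerivAt (fun s => ∑ i, (1 + Real.sin (2 * Real.pi * x i
        - 2 * Real.pi * x₀ i - Real.pi / 2 - 2 * Real.pi * ω i * s)))
        (∑ i, Real.cos (θ i) * (-(2 * Real.pi * ω i))) t := by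
      apply HasDerivAt.fun_sum
      intro i _
      have h := ((((hasDerivAt_id t).const_mul (2 * Real.pi * ω i)).const_sub
        (2 * Real.pi * x i - 2 * Real.pi * x₀ i - Real.pi / 2)).sin).const_add 1
      refine HasDerivAt.congr_deriv h ?_
      simp only [hθ, id]; ring
    convert (hs.const_mul ε).const_add c using 1
    rw [Finset.mul_sum, ← Finset.sum_neg_distrib]
    refine Finset.sum_congr rfl fun i _ => ?_
    simp only [hp]; ring
  have hpn : ‖p‖ ≤ ε * (2 * Real.pi) := by
    rw [pi_norm_le_iff_of_nonneg (by positivity)]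
    intro i
    simp only [hp, Real.norm_eq_abs, abs_mul, abs_of_pos hε, abs_of_pos hpi, abs_two]
    have := Real.abs_cos_le_one (θ i)
    exact mul_le_mul_of_nonneg_left (by nlinarith) hε.le
  have hpsq : ‖p‖ ^ 2 ≤ 8 * Real.pi ^ 2 * ε ^ 2 * S := by
    have : ‖p‖ ≤ √(8 * Real.pi ^ 2 * ε ^ 2 * S) := by
      rw [pi_norm_le_iff_of_nonneg (Real.sqrt_nonneg _)]
      intro i
      apply Real.abs_le_sqrt
      have h1 : 1 + Real.sin (θ i) ≤ S :=
        Finset.single_le_sum (f := fun i => 1 + Real.sin (θ i)) (fun i _ => hterm i)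
          (Finset.mem_univ i)
      have h2 : Real.cos (θ i) ^ 2 ≤ 2 * S := by
        nlinarith [Real.sin_sq_add_cos_sq (θ i), hterm i, Real.sin_le_one (θ i)]
      calc p i ^ 2 = 4 * Real.pi ^ 2 * ε ^ 2 * Real.cos (θ i) ^ 2 := by simp only [hp]; ring
        _ ≤ 4 * Real.pi ^ 2 * ε ^ 2 * (2 * S) := by gcongr
        _ = _ := by ring
    calc ‖p‖ ^ 2 ≤ √(8 * Real.pi ^ 2 * ε ^ 2 * S) ^ 2 := by gcongr
      _ = _ := Real.sq_sqrt (by positivity)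
  have hA := hT p (by nlinarith [mul_pos hε hpi])
  simp only [hc, sub_zero] at hA
  rw [hlin p] at hA
  have hB := hmono p _ hWc
  rw [htime, hgrad]
  have hC : K * ‖p‖ ^ 2 ≤ δ * (ε * S) := by
    calc K * ‖p‖ ^ 2 ≤ K * (8 * Real.pi ^ 2 * ε ^ 2 * S) := by gcongr
      _ = (ε * (8 * Real.pi ^ 2 * K)) * (ε * S) := by ring
      _ ≤ δ * (ε * S) := by gcongr
  have hD : W ε x t - c = ε * S := by rw [hWS]; ring
  rw [hD] at hB
  linarith
end

section
/- Let ω = (ω_1,…,ω_n) ∈ ℝⁿ, c ∈ ℝ, ε > 0, (k_1,…,k_n) ∈ ℤⁿ and T > 0 with (k_1ω_1 + ⋯ + k_nω_n)·T = 1, and let l := { y ∈ ℝⁿ : k_1y_1 + ⋯ + k_ny_n ∈ ℤ }. Then for all (x,t) ∈ ℝⁿ × ℝ, inf_{y ∈ l} W^ε_y(x, t+T) = inf_{y ∈ l} W^ε_y(x, t); that is, the function t ↦ inf_{y ∈ l} W^ε_y(x,t) is T-periodic. -/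
/-- If `(k₁ω₁ + ⋯ + kₙωₙ)·T = 1` with `T > 0` and `l := { y : k·y ∈ ℤ }`, then
`inf_{y ∈ l} W^ε_y(x, t+T) = inf_{y ∈ l} W^ε_y(x, t)`, i.e. `t ↦ inf_{y ∈ l} W^ε_y(x,t)`
is `T`-periodic. -/
theorem stmt_8 (n : ℕ) (ω : Fin n → ℝ) (c ε : ℝ) (hε : 0 < ε)
    (k : Fin n → ℤ) (T : ℝ) (hT : 0 < T) (hkT : (∑ i, (k i : ℝ) * ω i) * T = 1)
    (l : Set (Fin n → ℝ)) (hl : l = {y | ∃ m : ℤ, ∑ i, (k i : ℝ) * y i = (m : ℝ)})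
    (W : (Fin n → ℝ) → (Fin n → ℝ) → ℝ → ℝ)
    (hW : ∀ y x t, W y x t = c + ε * ∑ i,
      (1 + Real.sin (2 * Real.pi * x i - 2 * Real.pi * y i - Real.pi / 2
        - 2 * Real.pi * ω i * t)))
    (x : Fin n → ℝ) (t : ℝ) :
    sInf {w : ℝ | ∃ y ∈ l, w = W y x (t + T)} = sInf {w : ℝ | ∃ y ∈ l, w = W y x t} := by
  congr 1
  subst hl
  have hsum : ∑ i, (k i : ℝ) * (ω i * T) = 1 := by
    rw [← hkT, Finset.sum_mul]
    exact Finset.sum_congr rfl fun i _ => by ring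
  ext w
  constructor
  · rintro ⟨y, ⟨m, hm⟩, rfl⟩
    refine ⟨fun i => y i + ω i * T, ⟨m + 1, ?_⟩, ?_⟩
    · simp only [mul_add, Finset.sum_add_distrib]
      rw [hm, hsum]
      push_cast
      ring
    · rw [hW, hW]
      congr 2
      refine Finset.sum_congr rfl fun i _ => ?_
      congr 2
      ring
  · rintro ⟨y, ⟨m, hm⟩, rfl⟩
    refine ⟨fun i => y i - ω i * T, ⟨m - 1, ?_⟩, ?_⟩
    · simp only [mul_sub, Finset.sum_sub_distrib]
      rw [hm, hsum]
      push_cast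
      ring
    · rw [hW, hW]
      congr 2
      refine Finset.sum_congr rfl fun i _ => ?_
      congr 2
      ring
end

section
/- Let ω = (ω_1,…,ω_n) ∈ ℝⁿ, c ∈ ℝ, ε > 0, (k_1,…,k_n) ∈ ℤⁿ and T > 0 with (k_1ω_1 + ⋯ + k_nω_n)·T = 1, and let l := { y ∈ ℝⁿ : k_1y_1 + ⋯ + k_ny_n ∈ ℤ }. Then for every x_0 ∈ l, one has inf_{y ∈ l} W^ε_y(x_0, T/2) > c. -/
/-- If `(k₁ω₁ + ⋯ + kₙωₙ)·T = 1` with `T > 0` and `l := { y : k·y ∈ ℤ }`, then for every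
`x₀ ∈ l`, `inf_{y ∈ l} W^ε_y(x₀, T/2) > c`. -/
theorem stmt_9 (n : ℕ) (ω : Fin n → ℝ) (c ε : ℝ) (hε : 0 < ε)
    (k : Fin n → ℤ) (T : ℝ) (hT : 0 < T) (hkT : (∑ i, (k i : ℝ) * ω i) * T = 1)
    (l : Set (Fin n → ℝ)) (hl : l = {y | ∃ m : ℤ, ∑ i, (k i : ℝ) * y i = (m : ℝ)})
    (W : (Fin n → ℝ) → (Fin n → ℝ) → ℝ → ℝ)
    (hW : ∀ y x t, W y x t = c + ε * ∑ i,
      (1 + Real.sin (2 * Real.pi * x i - 2 * Real.pi * y i - Real.pi / 2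
        - 2 * Real.pi * ω i * t))) :
    ∀ x₀ ∈ l, c < sInf {w : ℝ | ∃ y ∈ l, w = W y x₀ (T / 2)} := by
  intro x₀ hx₀
  have hx₁ := hx₀
  rw [hl] at hx₁
  obtain ⟨a, ha⟩ := hx₁
  set K : ℝ := ∑ i, (k i : ℝ) ^ 2 with hK
  have hK0 : 0 ≤ K := Finset.sum_nonneg fun i _ => sq_nonneg _
  have hb : 0 < ε * (2 / (K + 1)) := by positivity
  suffices h : c + ε * (2 / (K + 1)) ≤ sInf {w : ℝ | ∃ y ∈ l, w = W y x₀ (T / 2)} by linarith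
  refine le_csInf ⟨W x₀ x₀ (T / 2), x₀, hx₀, rfl⟩ ?_
  rintro w ⟨y, hy, rfl⟩
  rw [hl] at hy
  obtain ⟨b, hb'⟩ := hy
  rw [hW]
  set z : Fin n → ℝ := fun i => x₀ i - y i - ω i * (T / 2) with hz
  set d : Fin n → ℝ := fun i => z i - round (z i) with hd
  have hterm : ∀ i, 8 * d i ^ 2 ≤ 1 + Real.sin (2 * Real.pi * x₀ i - 2 * Real.pi * y i
      - Real.pi / 2 - 2 * Real.pi * ω i * (T / 2)) := by
    intro i
    have e : 2 * Real.pi * x₀ i - 2 * Real.pi * y i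
      - Real.pi / 2 - 2 * Real.pi * ω i * (T / 2)
        = (2 * Real.pi * d i - Real.pi / 2) + (round (z i) : ℤ) * (2 * Real.pi) := by
      simp only [hd, hz]; ring
    rw [e, Real.sin_add_int_mul_two_pi, Real.sin_sub_pi_div_two]
    have h1 : |d i| ≤ 1 / 2 := abs_sub_round (z i)
    have h2 : |2 * Real.pi * d i| ≤ Real.pi := by
      rw [abs_mul, abs_of_pos Real.two_pi_pos]
      nlinarith [Real.pi_pos]
    have h3 := Real.cos_le_one_sub_mul_cos_sq h2
    have h4 : 2 / Real.pi ^ 2 * (2 * Real.pi * d i) ^ 2 = 8 * d i ^ 2 := by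
      field_simp [Real.pi_ne_zero]
      ring
    linarith
  have hsum : ∑ i, (k i : ℝ) * d i
      = ((a - b - ∑ i, k i * round (z i) : ℤ) : ℝ) - 1 / 2 := by
    have e : ∑ i, (k i : ℝ) * d i = ∑ i, (k i : ℝ) * x₀ i - ∑ i, (k i : ℝ) * y i
        - (∑ i, (k i : ℝ) * ω i) * (T / 2) - ∑ i, (k i : ℝ) * round (z i) := by
      rw [Finset.sum_mul, ← Finset.sum_sub_distrib, ← Finset.sum_sub_distrib,
        ← Finset.sum_sub_distrib]
      refine Finset.sum_congr rfl fun i _ => ?_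
      simp only [hd, hz]; ring
    rw [e, ha, hb']
    push_cast
    linarith
  have hsq : 1 / 4 ≤ (∑ i, (k i : ℝ) * d i) ^ 2 := by
    rw [hsum]
    generalize (a - b - ∑ i, k i * round (z i) : ℤ) = m
    rcases le_or_gt m 0 with h | h
    · have : (m : ℝ) ≤ 0 := by exact_mod_cast h
      nlinarith
    · have : (1 : ℝ) ≤ m := by exact_mod_cast h
      nlinarith
  have hcs := Finset.sum_mul_sq_le_sq_mul_sq Finset.univ (fun i => (k i : ℝ)) d
  have hS := Finset.sum_le_sum fun i (_ : i ∈ Finset.univ) => hterm i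
  rw [← Finset.mul_sum] at hS
  have hd0 : 0 ≤ ∑ i, d i ^ 2 := Finset.sum_nonneg fun i _ => sq_nonneg _
  have : 2 / (K + 1) ≤ 8 * ∑ i, d i ^ 2 := by
    rw [div_le_iff₀ (by linarith)]
    nlinarith
  have := mul_le_mul_of_nonneg_left (this.trans hS) hε.le
  linarith
end

section
/- Let ω = (ω_1,…,ω_n) ∈ ℝⁿ, c ∈ ℝ, ε > 0, (k_1,…,k_n) ∈ ℤⁿ, and let l := { y ∈ ℝⁿ : k_1y_1 + ⋯ + k_ny_n ∈ ℤ }. Then for every t ∈ ℝ, { x ∈ ℝⁿ : inf_{y ∈ l} W^ε_y(x,t) = c } = { x ∈ ℝⁿ : k_1(x_1 − ω_1 t) + ⋯ + k_n(x_n − ω_n t) ∈ ℤ }. -/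
theorem aux_term (a : ℝ) : 8 * (a - round a) ^ 2 ≤ 1 - Real.cos (2 * Real.pi * a) := by
  have h1 : Real.cos (2 * Real.pi * a) = Real.cos (2 * Real.pi * (a - round a)) := by
    rw [← Real.cos_sub_int_mul_two_pi (2 * Real.pi * a) (round a)]
    congr 1; ring
  have h2 : |2 * Real.pi * (a - round a)| ≤ Real.pi := by
    rw [abs_mul, abs_of_pos Real.two_pi_pos]
    nlinarith [abs_sub_round a, Real.pi_pos]
  have h3 := Real.cos_le_one_sub_mul_cos_sq h2
  have h4 : 2 / Real.pi ^ 2 * (2 * Real.pi * (a - round a)) ^ 2 = 8 * (a - round a) ^ 2 := by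
    have := Real.pi_ne_zero
    field_simp; ring
  rw [h1]; linarith

theorem stmt_10 (n : ℕ) (ω : Fin n → ℝ) (c ε : ℝ) (hε : 0 < ε)
    (k : Fin n → ℤ)
    (l : Set (Fin n → ℝ)) (hl : l = {y | ∃ m : ℤ, ∑ i, (k i : ℝ) * y i = (m : ℝ)})
    (W : (Fin n → ℝ) → (Fin n → ℝ) → ℝ → ℝ)
    (hW : ∀ y x t, W y x t = c + ε * ∑ i,
      (1 + Real.sin (2 * Real.pi * x i - 2 * Real.pi * y i - Real.pi / 2
        - 2 * Real.pi * ω i * t)))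
    (t : ℝ) :
    {x : Fin n → ℝ | sInf {w : ℝ | ∃ y ∈ l, w = W y x t} = c}
      = {x : Fin n → ℝ | ∃ m : ℤ, ∑ i, (k i : ℝ) * (x i - ω i * t) = (m : ℝ)} := by
  have hW' : ∀ y x, W y x t = c + ε * ∑ i,
      (1 - Real.cos (2 * Real.pi * (x i - ω i * t - y i))) := by
    intro y x
    rw [hW]
    congr 2
    refine Finset.sum_congr rfl fun i _ => ?_
    rw [sub_eq_add_neg 1, ← Real.sin_sub_pi_div_two]
    congr 2; ring
  have hlow : ∀ y x, c ≤ W y x t := by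
    intro y x
    rw [hW']
    have : 0 ≤ ∑ i, (1 - Real.cos (2 * Real.pi * (x i - ω i * t - y i))) :=
      Finset.sum_nonneg fun i _ => sub_nonneg.2 (Real.cos_le_one _)
    nlinarith [mul_nonneg hε.le this]
  ext x
  simp only [Set.mem_ofPred_eq]
  constructor
  · intro h
    set S := ∑ i, (k i : ℝ) * (x i - ω i * t) with hS
    by_contra hne
    have hδ : 0 < (S - round S) ^ 2 := by
      have : S - round S ≠ 0 := fun h0 => hne ⟨round S, by linarith⟩
      positivity
    set K : ℝ := ∑ i, (k i : ℝ) ^ 2 with hK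
    have hK0 : 0 ≤ K := Finset.sum_nonneg fun i _ => sq_nonneg _
    have key : c + ε * (8 * (S - round S) ^ 2 / (K + 1)) ≤
        sInf {w : ℝ | ∃ y ∈ l, w = W y x t} := by
      refine le_csInf ⟨_, 0, ?_, rfl⟩ ?_
      · rw [hl]; exact ⟨0, by simp⟩
      · rintro w ⟨y, hy, rfl⟩
        rw [hl] at hy
        obtain ⟨m, hm⟩ := hy
        rw [hW']
        set d : Fin n → ℝ := fun i => (x i - ω i * t - y i) - round (x i - ω i * t - y i) with hd
        have e1 : ∑ i, 8 * d i ^ 2 ≤ ∑ i, (1 - Real.cos (2 * Real.pi * (x i - ω i * t - y i))) :=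
          Finset.sum_le_sum fun i _ => aux_term _
        rw [← Finset.mul_sum] at e1
        have e2 : (∑ i, (k i : ℝ) * d i) ^ 2 ≤ K * ∑ i, d i ^ 2 :=
          Finset.sum_mul_sq_le_sq_mul_sq _ _ _
        have e3 : ∑ i, (k i : ℝ) * d i =
            S - ((m + ∑ i, k i * round (x i - ω i * t - y i) : ℤ) : ℝ) := by
          push_cast
          rw [← hm, hS, ← Finset.sum_add_distrib, ← Finset.sum_sub_distrib]
          refine Finset.sum_congr rfl fun i _ => ?_
          simp only [hd]; ring
        have e4 : (S - round S) ^ 2 ≤ (∑ i, (k i : ℝ) * d i) ^ 2 := by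
          rw [e3]
          exact sq_le_sq.2 (round_le S _)
        have e5 : 0 ≤ ∑ i, d i ^ 2 := Finset.sum_nonneg fun i _ => sq_nonneg _
        have e6 : 8 * (S - round S) ^ 2 / (K + 1) ≤ 8 * ∑ i, d i ^ 2 := by
          rw [div_le_iff₀ (by linarith)]
          nlinarith
        have := mul_le_mul_of_nonneg_left (e6.trans e1) hε.le
        linarith
    rw [h] at key
    have : 0 < ε * (8 * (S - round S) ^ 2 / (K + 1)) := by positivity
    linarith
  · intro h
    refine IsLeast.csInf_eq ⟨⟨fun i => x i - ω i * t, ?_, ?_⟩, ?_⟩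
    · rw [hl]; exact h
    · rw [hW']; simp
    · rintro w ⟨y, _, rfl⟩
      exact hlow y x
end

section
/- Let f, g : ℝ → ℝ be continuous functions such that f is T_1-periodic and g is T_2-periodic for some T_1 > 0 and T_2 > 0. Then the function h(t) := min{ f(t), g(t) } is Bohr almost periodic: for every ε > 0, the set B(h,ε) := { τ > 0 : |h(t+τ) − h(t)| ≤ ε for all t ∈ ℝ } is relatively dense in [0,+∞), i.e., there exists L > 0 such that every closed interval of length L contained in [0,+∞) contains a point of B(h,ε). -/
theorem uc_of_periodic_aux (g : ℝ → ℝ) (hg : Continuous g) (T : ℝ) (hT : 0 < T)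
    (hp : Function.Periodic g T) (ε : ℝ) (hε : 0 < ε) :
    ∃ δ > 0, ∀ t s : ℝ, |s| < δ → |g (t + s) - g t| ≤ ε := by
  have h := (isCompact_Icc (a := (-1 : ℝ)) (b := T + 1)).uniformContinuousOn_of_continuous
    hg.continuousOn
  rw [Metric.uniformContinuousOn_iff] at h
  obtain ⟨δ, hδ, h⟩ := h ε hε
  refine ⟨min δ 1, by positivity, fun t s hs => ?_⟩
  have hs1 := lt_of_lt_of_le hs (min_le_left _ _)
  have hs2 := abs_lt.mp (lt_of_lt_of_le hs (min_le_right _ _))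
  obtain ⟨u, ⟨hu0, hu1⟩, n, hn⟩ : ∃ u : ℝ, (0 ≤ u ∧ u < T) ∧ ∃ n : ℤ, t = u + n * T := by
    refine ⟨t - ⌊t / T⌋ * T, ⟨?_, ?_⟩, ⌊t / T⌋, by ring⟩
    · have := (le_div_iff₀ hT).mp (Int.floor_le (t / T))
      linarith
    · have := (div_lt_iff₀ hT).mp (Int.lt_floor_add_one (t / T))
      linarith
  have e1 : g t = g u := by rw [hn]; exact hp.int_mul n u
  have e2 : g (t + s) = g (u + s) := by
    rw [hn, show u + n * T + s = (u + s) + n * T by ring]; exact hp.int_mul n _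
  rw [e1, e2]
  have := h (u + s) ⟨by linarith, by linarith⟩ u ⟨by linarith, by linarith⟩
    (by rw [Real.dist_eq]; simpa using hs1)
  rw [Real.dist_eq] at this
  exact this.le

/-- The pointwise minimum of a continuous `T₁`-periodic and a continuous `T₂`-periodic
function on `ℝ` is Bohr almost periodic: for every `ε > 0` the set of its `ε`-periods is
relatively dense in `[0,+∞)`. -/
theorem stmt_13 (f g : ℝ → ℝ) (hf : Continuous f) (hg : Continuous g)
    (T₁ T₂ : ℝ) (hT₁ : 0 < T₁) (hT₂ : 0 < T₂)
    (hpf : ∀ t, f (t + T₁) = f t) (hpg : ∀ t, g (t + T₂) = g t) :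
    ∀ ε > 0, ∃ L > 0, ∀ a : ℝ, 0 ≤ a → ∃ τ ∈ Set.Icc a (a + L), 0 < τ ∧
      ∀ t : ℝ, |min (f (t + τ)) (g (t + τ)) - min (f t) (g t)| ≤ ε := by
  intro ε hε
  have hpf' : Function.Periodic f T₁ := hpf
  have hpg' : Function.Periodic g T₂ := hpg
  obtain ⟨δ, hδ, hu⟩ := uc_of_periodic_aux g hg T₂ hT₂ hpg' ε hε
  obtain ⟨N, hN⟩ := exists_nat_gt (T₂ / δ)
  have hN0 : (0 : ℝ) < N := lt_trans (by positivity) hN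
  have hNd : T₂ < N * δ := (div_lt_iff₀ hδ).mp hN
  let b : ℕ → ℤ := fun m => ⌊Int.fract (m * T₁ / T₂) * N⌋
  have hfin : (Set.range b).Finite := by
    refine (Set.finite_Icc (0 : ℤ) N).subset ?_
    rintro _ ⟨m, rfl⟩
    refine ⟨Int.floor_nonneg.mpr (mul_nonneg (Int.fract_nonneg _) hN0.le), ?_⟩
    have h1 : Int.fract (m * T₁ / T₂) * N ≤ N :=
      mul_le_of_le_one_left hN0.le (Int.fract_lt_one _).le
    exact_mod_cast (Int.floor_le _).trans h1
  obtain ⟨M, hM⟩ : ∃ M : ℕ, ∀ m, ∃ j ≤ M, b j = b m := by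
    have hc : ∀ k : Set.range b, ∃ j, b j = k := fun k => k.2
    choose c hc using hc
    haveI := hfin.to_subtype
    obtain ⟨M, hM⟩ := (Set.finite_range c).bddAbove
    exact ⟨M, fun m => ⟨c ⟨b m, m, rfl⟩, hM ⟨_, rfl⟩, hc _⟩⟩
  refine ⟨(M + 2) * T₁, by positivity, fun a ha => ?_⟩
  set K := ⌈a / T₁⌉₊ with hK
  have hK1 : a ≤ K * T₁ := (div_le_iff₀ hT₁).mp (Nat.le_ceil _)
  have hK2 : K * T₁ < a + T₁ := by
    have := Nat.ceil_lt_add_one (a := a / T₁) (by positivity)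
    have h2 := mul_lt_mul_of_pos_right this hT₁
    rwa [add_mul, div_mul_cancel₀ _ hT₁.ne', one_mul] at h2
  obtain ⟨j, hj, hb⟩ := hM (K + M + 1)
  have hjR : (j : ℝ) ≤ M := by exact_mod_cast hj
  have hj0 : (0 : ℝ) ≤ j := by positivity
  have p1 : (j : ℝ) * T₁ ≤ M * T₁ := by gcongr
  have p2 : 0 ≤ (j : ℝ) * T₁ := by positivity
  refine ⟨(((K + M + 1 : ℕ) : ℝ) - j) * T₁, ⟨?_, ?_⟩, ?_, fun t => ?_⟩
  · push_cast; linarith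
  · push_cast; linarith
  · push_cast; linarith
  set m := K + M + 1 with hm
  have ef : f (t + ((m : ℝ) - j) * T₁) = f t := by
    have := hpf'.int_mul ((m : ℤ) - j) t
    push_cast at this
    exact this
  refine (abs_min_sub_min_le_max _ _ _ _).trans (max_le ?_ ?_)
  · rw [ef]; simpa using hε.le
  set x := (m : ℝ) * T₁ / T₂ with hx
  set y := (j : ℝ) * T₁ / T₂ with hy
  have hxy : |Int.fract y * N - Int.fract x * N| < 1 := Int.abs_sub_lt_one_of_floor_eq_floor hb
  have key : ((m : ℝ) - j) * T₁ = (Int.fract x - Int.fract y) * T₂ + ((⌊x⌋ - ⌊y⌋ : ℤ) : ℝ) * T₂ := by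
    have h1 : (m : ℝ) * T₁ = x * T₂ := by rw [hx]; field_simp
    have h2 : (j : ℝ) * T₁ = y * T₂ := by rw [hy]; field_simp
    rw [sub_mul, h1, h2, ← Int.self_sub_floor, ← Int.self_sub_floor]
    push_cast
    ring
  rw [key, ← add_assoc, hpg'.int_mul _ _]
  apply hu
  rw [← sub_mul, abs_mul, abs_of_pos hN0, abs_sub_comm] at hxy
  rw [abs_mul, abs_of_pos hT₂]
  have h0 := abs_nonneg (Int.fract x - Int.fract y)
  rcases h0.eq_or_lt with h0 | h0
  · rw [← h0]; simpa using hδ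
  · nlinarith
end

section
/- Let λ > 0, ω = (ω_1,…,ω_n) ∈ ℝⁿ and x_0 = (x_1^0,…,x_n^0) ∈ ℝⁿ, and define w_{x_0}(x,t) := ∑_{i=1}^n inf_{k ∈ ℤ} (λ/4)(x_i − x_i^0 + k − ω_i t)² for (x,t) ∈ ℝⁿ × ℝ. Then at every point (x,t) such that x_i − x_i^0 − ω_i t ∉ 1/2 + ℤ for all i ∈ {1,…,n}, the function w_{x_0} is differentiable and satisfies the Hamilton–Jacobi equation ∂_t w_{x_0}(x,t) + ⟨∇_x w_{x_0}(x,t), ∇_x w_{x_0}(x,t)⟩ + ⟨ω, ∇_x w_{x_0}(x,t)⟩ − λ w_{x_0}(x,t) = 0. -/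
open Filter Topology

lemma iInf_aux (lam : ℝ) (hlam : 0 < lam) (a b : ℝ) (m : ℤ) (h : |a - b - m| ≤ 1 / 2) :
    (⨅ k : ℤ, (lam / 4) * (a + (k : ℝ) - b) ^ 2) = (lam / 4) * (a - m - b) ^ 2 := by
  apply le_antisymm
  · have hb : BddBelow (Set.range fun k : ℤ => (lam / 4) * (a + (k : ℝ) - b) ^ 2) :=
      ⟨0, by rintro _ ⟨k, rfl⟩; positivity⟩
    refine (ciInf_le hb (-m)).trans (le_of_eq ?_)
    push_cast
    ring
  · refine le_ciInf fun k => ?_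
    apply mul_le_mul_of_nonneg_left _ (by positivity)
    rw [abs_le] at h
    have key : ∀ j : ℤ, 0 ≤ (j : ℝ) ^ 2 + 2 * j * (a - b - m) := by
      intro j
      rcases lt_trichotomy j 0 with hj | hj | hj
      · have : (j : ℝ) ≤ -1 := by exact_mod_cast (by omega : j ≤ -1)
        nlinarith
      · simp [hj]
      · have : (1 : ℝ) ≤ j := by exact_mod_cast hj
        nlinarith
    have := key (k + m)
    push_cast at this
    nlinarith

/-- With `w_{x₀}(x,t) := ∑ᵢ inf_{k ∈ ℤ} (λ/4)(xᵢ − x₀ᵢ + k − ωᵢt)²`, at every point `(x,t)`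
with `xᵢ − x₀ᵢ − ωᵢt ∉ 1/2 + ℤ` for all `i`, the function `w_{x₀}` is differentiable and
satisfies `∂ₜw + ⟨∇ₓw, ∇ₓw⟩ + ⟨ω, ∇ₓw⟩ − λw = 0`. -/
theorem stmt_14 (n : ℕ) (lam : ℝ) (hlam : 0 < lam) (ω x₀ : Fin n → ℝ)
    (w : (Fin n → ℝ) → ℝ → ℝ)
    (hw : ∀ x t, w x t = ∑ i, ⨅ k : ℤ, (lam / 4) * (x i - x₀ i + (k : ℝ) - ω i * t) ^ 2)
    (x : Fin n → ℝ) (t : ℝ)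
    (hxt : ∀ (i : Fin n) (m : ℤ), x i - x₀ i - ω i * t ≠ 1 / 2 + (m : ℝ)) :
    DifferentiableAt ℝ (fun p : (Fin n → ℝ) × ℝ => w p.1 p.2) (x, t) ∧
    deriv (fun s => w x s) t
        + (∑ j, (deriv (fun y => w (Function.update x j y) t) (x j)) ^ 2)
        + (∑ j, ω j * deriv (fun y => w (Function.update x j y) t) (x j))
        - lam * w x t = 0 := by
  set m : Fin n → ℤ := fun i => round (x i - x₀ i - ω i * t) with hm
  have hlt : ∀ i, |x i - x₀ i - ω i * t - m i| < 1 / 2 := by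
    intro i
    refine lt_of_le_of_ne (abs_sub_round _) fun h => ?_
    change |x i - x₀ i - ω i * t - m i| = 1 / 2 at h
    rcases (abs_eq (by norm_num)).1 h with h | h
    · exact hxt i (m i) (by linarith)
    · exact hxt i (m i - 1) (by push_cast; linarith)
  have hev : ∀ᶠ p : (Fin n → ℝ) × ℝ in 𝓝 (x, t),
      w p.1 p.2 = ∑ i, (lam / 4) * (p.1 i - x₀ i - m i - ω i * p.2) ^ 2 := by
    have h1 : ∀ᶠ p : (Fin n → ℝ) × ℝ in 𝓝 (x, t),
        ∀ i, |p.1 i - x₀ i - ω i * p.2 - m i| < 1 / 2 := by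
      rw [eventually_all]
      intro i
      have hc : Continuous fun p : (Fin n → ℝ) × ℝ => |p.1 i - x₀ i - ω i * p.2 - m i| := by
        fun_prop
      exact hc.continuousAt.eventually_lt continuousAt_const (hlt i)
    filter_upwards [h1] with p hp
    rw [hw]
    exact Finset.sum_congr rfl fun i _ => iInf_aux lam hlam _ _ _ (hp i).le
  have hwx : w x t = ∑ i, (lam / 4) * (x i - x₀ i - m i - ω i * t) ^ 2 := hev.self_of_nhds
  have hdt : deriv (fun s => w x s) t
      = ∑ i, (lam / 4) * (2 * (x i - x₀ i - m i - ω i * t) * (-ω i)) := by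
    have hc : Tendsto (fun s : ℝ => (x, s)) (𝓝 t) (𝓝 (x, t)) :=
      (by fun_prop : Continuous fun s : ℝ => (x, s)).tendsto t
    have he : (fun s => w x s) =ᶠ[𝓝 t]
        fun s => ∑ i, (lam / 4) * (x i - x₀ i - m i - ω i * s) ^ 2 := hc.eventually hev
    rw [he.deriv_eq]
    refine HasDerivAt.deriv (HasDerivAt.fun_sum fun i _ => ?_)
    have h1 := (((hasDerivAt_id t).const_mul (ω i)).const_sub (x i - x₀ i - m i)).fun_pow 2
    refine (h1.const_mul (lam / 4)).congr_deriv ?_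
    simp
  have hdx : ∀ j, deriv (fun y => w (Function.update x j y) t) (x j)
      = (lam / 2) * (x j - x₀ j - m j - ω j * t) := by
    intro j
    have hc : Tendsto (fun y : ℝ => (Function.update x j y, t)) (𝓝 (x j)) (𝓝 (x, t)) := by
      have h := (by fun_prop : Continuous fun y : ℝ => (Function.update x j y, t)).tendsto (x j)
      simpa using h
    have he : (fun y => w (Function.update x j y) t) =ᶠ[𝓝 (x j)]
        fun y => ∑ i, (lam / 4) * (Function.update x j y i - x₀ i - m i - ω i * t) ^ 2 :=
      hc.eventually hev
    rw [he.deriv_eq]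
    have h2 : HasDerivAt
        (fun y => ∑ i, (lam / 4) * (Function.update x j y i - x₀ i - m i - ω i * t) ^ 2)
        (∑ i, if i = j then (lam / 2) * (x i - x₀ i - m i - ω i * t) else 0) (x j) := by
      refine HasDerivAt.fun_sum fun i _ => ?_
      by_cases hij : i = j
      · subst hij
        simp only [Function.update_self, if_true]
        have h1 := ((((hasDerivAt_id (x i)).sub_const (x₀ i)).sub_const (m i : ℝ)).sub_const
          (ω i * t)).fun_pow 2
        refine (h1.const_mul (lam / 4)).congr_deriv ?_
        simp
        ring
      · simp only [Function.update_of_ne hij, if_neg hij]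
        exact hasDerivAt_const _ _
    rw [h2.deriv]
    simp
  refine ⟨?_, ?_⟩
  · refine DifferentiableAt.congr_of_eventuallyEq ?_ hev
    fun_prop
  · simp only [hdx]
    rw [hdt, hwx, Finset.mul_sum, ← Finset.sum_add_distrib, ← Finset.sum_add_distrib,
      ← Finset.sum_sub_distrib]
    refine Finset.sum_eq_zero fun i _ => ?_
    ring
end

section
/- Let λ > 0, ω = (ω_1,…,ω_n) ∈ ℝⁿ, (k_1,…,k_n) ∈ ℤⁿ and T > 0 with (k_1ω_1 + ⋯ + k_nω_n)·T = 1, and let l := { x_0 ∈ ℝⁿ : k_1 x_1^0 + ⋯ + k_n x_n^0 ∈ ℤ }. Define u(x,t) := inf_{x_0 ∈ l} w_{x_0}(x,t). Then u(x, t+T) = u(x,t) for all (x,t) ∈ ℝⁿ × ℝ; that is, u is T-periodic in time. -/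
/-- With `w_{x₀}(x,t) := ∑ᵢ inf_{k ∈ ℤ} (λ/4)(xᵢ − x₀ᵢ + k − ωᵢt)²`, if
`(k₁ω₁ + ⋯ + kₙωₙ)·T = 1` with `T > 0` and `l := { x₀ : k·x₀ ∈ ℤ }`, then
`u(x,t) := inf_{x₀ ∈ l} w_{x₀}(x,t)` is `T`-periodic in time. -/
theorem stmt_15 (n : ℕ) (lam : ℝ) (hlam : 0 < lam) (ω : Fin n → ℝ)
    (k : Fin n → ℤ) (T : ℝ) (hT : 0 < T) (hkT : (∑ i, (k i : ℝ) * ω i) * T = 1)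
    (l : Set (Fin n → ℝ)) (hl : l = {x₀ | ∃ m : ℤ, ∑ i, (k i : ℝ) * x₀ i = (m : ℝ)})
    (w : (Fin n → ℝ) → (Fin n → ℝ) → ℝ → ℝ)
    (hw : ∀ x₀ x t, w x₀ x t
      = ∑ i, ⨅ j : ℤ, (lam / 4) * (x i - x₀ i + (j : ℝ) - ω i * t) ^ 2)
    (u : (Fin n → ℝ) → ℝ → ℝ)
    (hu : ∀ x t, u x t = sInf {v : ℝ | ∃ x₀ ∈ l, v = w x₀ x t}) :
    ∀ (x : Fin n → ℝ) (t : ℝ), u x (t + T) = u x t := by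
  intro x t
  rw [hu, hu]
  congr 1
  have hsum : ∑ i, (k i : ℝ) * (ω i * T) = 1 := by
    rw [← hkT, Finset.sum_mul]
    exact Finset.sum_congr rfl fun i _ => by ring
  ext v
  subst hl
  constructor
  · rintro ⟨x₀, ⟨m, hm⟩, rfl⟩
    refine ⟨fun i => x₀ i + ω i * T, ⟨m + 1, ?_⟩, ?_⟩
    · simp only [mul_add, Finset.sum_add_distrib, hsum, hm]
      push_cast
      ring
    · rw [hw, hw]
      refine Finset.sum_congr rfl fun i _ => iInf_congr fun j => ?_
      ring
  · rintro ⟨x₀, ⟨m, hm⟩, rfl⟩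
    refine ⟨fun i => x₀ i - ω i * T, ⟨m - 1, ?_⟩, ?_⟩
    · simp only [mul_sub, Finset.sum_sub_distrib, hsum, hm]
      push_cast
      ring
    · rw [hw, hw]
      refine Finset.sum_congr rfl fun i _ => iInf_congr fun j => ?_
      ring
end

section
/- Let λ > 0, ω = (ω_1,…,ω_n) ∈ ℝⁿ, (k_1,…,k_n) ∈ ℤⁿ and T > 0 with (k_1ω_1 + ⋯ + k_nω_n)·T = 1, let l := { x_0 ∈ ℝⁿ : k_1 x_1^0 + ⋯ + k_n x_n^0 ∈ ℤ }, and define u(x,t) := inf_{x_0 ∈ l} w_{x_0}(x,t). Then for every x ∈ l one has u(x,0) = 0 and u(x, T/2) > 0; in particular, the function t ↦ u(x,t) is not constant. -/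
/-- With `u(x,t) := inf_{x₀ ∈ l} w_{x₀}(x,t)` as in the example, for every `x ∈ l` one has
`u(x,0) = 0` and `u(x,T/2) > 0`; in particular `t ↦ u(x,t)` is not constant. -/
theorem stmt_16 (n : ℕ) (lam : ℝ) (hlam : 0 < lam) (ω : Fin n → ℝ)
    (k : Fin n → ℤ) (T : ℝ) (hT : 0 < T) (hkT : (∑ i, (k i : ℝ) * ω i) * T = 1)
    (l : Set (Fin n → ℝ)) (hl : l = {x₀ | ∃ m : ℤ, ∑ i, (k i : ℝ) * x₀ i = (m : ℝ)})
    (w : (Fin n → ℝ) → (Fin n → ℝ) → ℝ → ℝ)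
    (hw : ∀ x₀ x t, w x₀ x t
      = ∑ i, ⨅ j : ℤ, (lam / 4) * (x i - x₀ i + (j : ℝ) - ω i * t) ^ 2)
    (u : (Fin n → ℝ) → ℝ → ℝ)
    (hu : ∀ x t, u x t = sInf {v : ℝ | ∃ x₀ ∈ l, v = w x₀ x t}) :
    ∀ x ∈ l, u x 0 = 0 ∧ 0 < u x (T / 2) ∧ ∃ t₁ t₂ : ℝ, u x t₁ ≠ u x t₂ := by
  have hnn : ∀ x₀ x t, 0 ≤ w x₀ x t := by
    intro x₀ x t
    rw [hw]
    exact Finset.sum_nonneg fun i _ => Real.iInf_nonneg fun j => by positivity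
  intro x hx
  have h0 : u x 0 = 0 := by
    rw [hu]
    have hmem : (0 : ℝ) ∈ {v : ℝ | ∃ x₀ ∈ l, v = w x₀ x 0} := by
      refine ⟨x, hx, le_antisymm (hnn _ _ _) ?_⟩
      rw [hw]
      refine Finset.sum_nonpos fun i _ => ?_
      refine (ciInf_le ⟨0, ?_⟩ (0 : ℤ)).trans ?_
      · rintro _ ⟨j, rfl⟩
        positivity
      · simp
    refine le_antisymm (csInf_le ⟨0, ?_⟩ hmem) (le_csInf ⟨0, hmem⟩ ?_)
    all_goals
      rintro _ ⟨x₀, _, rfl⟩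
      exact hnn _ _ _
  have h1 : 0 < u x (T / 2) := by
    set K : ℝ := ∑ i, (k i : ℝ) ^ 2 with hK
    have hK0 : 0 ≤ K := Finset.sum_nonneg fun i _ => sq_nonneg _
    have hpos : 0 < lam / (16 * (K + 1)) := by positivity
    refine hpos.trans_le ?_
    rw [hu]
    refine le_csInf ⟨_, x, hx, rfl⟩ ?_
    rintro _ ⟨x₀, hx₀, rfl⟩
    rw [hw]
    set a : Fin n → ℝ := fun i => x i - x₀ i - ω i * (T / 2) with ha
    set y : Fin n → ℝ := fun i => a i - (round (a i) : ℝ) with hy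
    have hle : ∑ i, (lam / 4) * y i ^ 2
        ≤ ∑ i, ⨅ j : ℤ, (lam / 4) * (x i - x₀ i + (j : ℝ) - ω i * (T / 2)) ^ 2 := by
      refine Finset.sum_le_sum fun i _ => le_ciInf fun j => ?_
      refine mul_le_mul_of_nonneg_left ?_ (by positivity)
      have h := round_le (a i) (-j)
      rw [sq_le_sq]
      refine h.trans (le_of_eq ?_)
      congr 1
      simp only [ha]
      push_cast
      ring
    refine le_trans ?_ hle
    rw [← Finset.mul_sum]
    rw [hl] at hx hx₀
    obtain ⟨m, hm⟩ := hx
    obtain ⟨m₀, hm₀⟩ := hx₀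
    have hsum : ∑ i, (k i : ℝ) * y i
        = ((m - m₀ - ∑ i, k i * round (a i) : ℤ) : ℝ) - 1 / 2 := by
      have e : ∀ i, (k i : ℝ) * y i = (k i : ℝ) * x i - (k i : ℝ) * x₀ i
          - (k i : ℝ) * ω i * (T / 2) - (k i : ℝ) * (round (a i) : ℝ) := by
        intro i
        simp only [hy]
        have : a i = x i - x₀ i - ω i * (T / 2) := rfl
        linear_combination (k i : ℝ) * this
      rw [Finset.sum_congr rfl fun i _ => e i]
      simp only [Finset.sum_sub_distrib, ← Finset.sum_mul]
      push_cast
      rw [hm, hm₀]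
      linear_combination (-1 / 2) * hkT
    have hcs : (∑ i, (k i : ℝ) * y i) ^ 2 ≤ K * ∑ i, y i ^ 2 :=
      Finset.sum_mul_sq_le_sq_mul_sq _ _ _
    have hS : 0 ≤ ∑ i, y i ^ 2 := Finset.sum_nonneg fun i _ => sq_nonneg _
    rw [hsum] at hcs
    have hq : ∀ z : ℤ, (1 / 4 : ℝ) ≤ ((z : ℝ) - 1 / 2) ^ 2 := by
      intro z
      have : (0 : ℤ) ≤ z * (z - 1) := by
        rcases le_or_gt z 0 with h | h
        · exact mul_nonneg_of_nonpos_of_nonpos h (by omega)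
        · exact mul_nonneg (by omega) (by omega)
      have : (0 : ℝ) ≤ z * (z - 1) := by exact_mod_cast this
      nlinarith
    have h4 := (hq _).trans hcs
    rw [div_le_iff₀ (by positivity)]
    nlinarith
  exact ⟨h0, h1, 0, T / 2, by rw [h0]; exact h1.ne⟩
end

section
/- Let λ > 0 and ω = (ω_1,…,ω_n) ∈ ℝⁿ. Let r = (r_1,…,r_n), s = (s_1,…,s_n) ∈ ℤⁿ and T_1, T_2 > 0 satisfy (r_1ω_1 + ⋯ + r_nω_n)·T_1 = 1 and (s_1ω_1 + ⋯ + s_nω_n)·T_2 = 1. Define S_r := { x_0 ∈ ℝⁿ : r_1x_1^0 + ⋯ + r_nx_n^0 ∈ ℤ }, S_s := { x_0 ∈ ℝⁿ : s_1x_1^0 + ⋯ + s_nx_n^0 ∈ ℤ }, and ũ(x,t) := min{ inf_{x_0 ∈ S_r} w_{x_0}(x,t), inf_{x_0 ∈ S_s} w_{x_0}(x,t) }. Then for every fixed x ∈ ℝⁿ, the function t ↦ ũ(x,t) is Bohr almost periodic on ℝ. -/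
lemma aux_phi_le (c y d : ℝ) (hc : 0 ≤ c) :
    (⨅ j : ℤ, c * (y + d + (j : ℝ)) ^ 2) ≤ (⨅ j : ℤ, c * (y + (j : ℝ)) ^ 2) + c * (|d| + d ^ 2) := by
  have hb : ∀ z : ℝ, BddBelow (Set.range fun j : ℤ => c * (z + (j : ℝ)) ^ 2) := by
    intro z
    refine ⟨0, ?_⟩
    rintro _ ⟨j, rfl⟩
    positivity
  have h1 : (⨅ j : ℤ, c * (y + d + (j : ℝ)) ^ 2) ≤ c * (y + d + ((-round y : ℤ) : ℝ)) ^ 2 :=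
    ciInf_le (hb (y + d)) (-round y)
  have hr := abs_sub_round y
  have h2 : c * (y + ((-round y : ℤ) : ℝ)) ^ 2 ≤ ⨅ j : ℤ, c * (y + (j : ℝ)) ^ 2 := by
    refine le_ciInf fun j => ?_
    refine mul_le_mul_of_nonneg_left ?_ hc
    rw [sq_le_sq]
    have := round_le y (-j)
    push_cast at this ⊢
    rwa [sub_neg_eq_add, sub_eq_add_neg] at this
  push_cast at h1 h2
  set e := y + -(round y : ℝ) with he
  have he' : |e| ≤ 1 / 2 := by rw [he, ← sub_eq_add_neg]; exact hr
  have h3 : (y + d + -(round y : ℝ)) ^ 2 ≤ e ^ 2 + (|d| + d ^ 2) := by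
    have e1 : (y + d + -(round y : ℝ)) = e + d := by rw [he]; ring
    rw [e1]
    have : 2 * (e * d) ≤ |d| := by
      have h4 : e * d ≤ |e| * |d| := by rw [← abs_mul]; exact le_abs_self _
      nlinarith [abs_nonneg d]
    nlinarith
  have := mul_le_mul_of_nonneg_left h3 hc
  linarith

lemma aux_return (T : ℝ) (hT : 0 < T) (β : ℝ) (hβ : 0 < β) :
    ∃ J : ℕ, ∀ M : ℕ, ∃ j : ℕ, j ≤ J ∧ ∃ m : ℤ, |((M : ℝ) + j) * β - m * T| ≤ β := by
  refine ⟨⌈T / β⌉₊, fun M => ?_⟩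
  set m := ⌈(M : ℝ) * β / T⌉ with hm
  have h1 : (M : ℝ) * β ≤ m * T := by
    rw [← div_le_iff₀ hT]; exact Int.le_ceil _
  have h2 : (m : ℝ) * T < M * β + T := by
    have := Int.ceil_lt_add_one ((M : ℝ) * β / T)
    rw [← hm] at this
    have h := mul_lt_mul_of_pos_right this hT
    rw [add_mul, div_mul_cancel₀ _ hT.ne'] at h
    linarith
  have h0 : 0 ≤ (m * T - M * β) / β := div_nonneg (by linarith) hβ.le
  refine ⟨⌈(m * T - M * β) / β⌉₊, ?_, m, ?_⟩
  · apply Nat.ceil_mono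
    gcongr
    linarith
  · have h3 := Nat.le_ceil ((m * T - M * β) / β)
    have h4 := Nat.ceil_lt_add_one h0
    rw [div_le_iff₀ hβ] at h3
    have h5 := mul_lt_mul_of_pos_right h4 hβ
    rw [add_mul, div_mul_cancel₀ _ hβ.ne'] at h5
    rw [abs_le]
    constructor <;> linarith

lemma aux_return' (T : ℝ) (hT : 0 < T) (β : ℝ) :
    ∃ J : ℕ, ∀ M : ℕ, ∃ j : ℕ, j ≤ J ∧ ∃ m : ℤ, |((M : ℝ) + j) * β - m * T| ≤ |β| := by
  rcases lt_trichotomy β 0 with h | h | h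
  · obtain ⟨J, hJ⟩ := aux_return T hT (-β) (by linarith)
    refine ⟨J, fun M => ?_⟩
    obtain ⟨j, hj, m, hm⟩ := hJ M
    refine ⟨j, hj, -m, ?_⟩
    rw [abs_of_neg h, ← abs_neg]
    convert hm using 2
    push_cast; ring
  · subst h
    exact ⟨0, fun M => ⟨0, le_rfl, 0, by simp⟩⟩
  · obtain ⟨J, hJ⟩ := aux_return T hT β h
    rw [abs_of_pos h]
    exact ⟨J, hJ⟩

lemma aux_dense (T₁ T₂ : ℝ) (hT₁ : 0 < T₁) (hT₂ : 0 < T₂) (δ : ℝ) (hδ : 0 < δ) :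
    ∃ L > 0, ∀ a : ℝ, 0 ≤ a → ∃ k : ℕ, ∃ m : ℤ, (k : ℝ) * T₂ ∈ Set.Icc a (a + L) ∧
      0 < (k : ℝ) * T₂ ∧ |(k : ℝ) * T₂ - m * T₁| < δ := by
  obtain ⟨N, hN⟩ := exists_nat_gt (T₁ / δ)
  have hN0 : 0 < N := by
    have : (0 : ℝ) < N := lt_trans (by positivity) hN
    exact_mod_cast this
  obtain ⟨q, p, hp, -, hpq⟩ := Real.exists_int_int_abs_mul_sub_le (T₂ / T₁) hN0
  lift p to ℕ using hp.le
  have hp' : (0 : ℝ) < p := by exact_mod_cast hp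
  have hβ : |(p : ℝ) * T₂ - q * T₁| < δ := by
    have e : (p : ℝ) * T₂ - q * T₁ = ((p : ℝ) * (T₂ / T₁) - q) * T₁ := by field_simp
    rw [e, abs_mul, abs_of_pos hT₁]
    push_cast at hpq
    have h1 := mul_le_mul_of_nonneg_right hpq hT₁.le
    refine lt_of_le_of_lt h1 ?_
    rw [div_mul_eq_mul_div, one_mul, div_lt_iff₀ (by positivity)]
    rw [div_lt_iff₀ hδ] at hN
    nlinarith
  obtain ⟨J, hJ⟩ := aux_return' T₁ hT₁ ((p : ℝ) * T₂ - q * T₁)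
  have hP : 0 < (p : ℝ) * T₂ := by positivity
  refine ⟨(2 + J) * ((p : ℝ) * T₂), by positivity, fun a ha => ?_⟩
  obtain ⟨j, hj, m, hm⟩ := hJ (⌈a / ((p : ℝ) * T₂)⌉₊ + 1)
  have c1 := Nat.le_ceil (a / ((p : ℝ) * T₂))
  have c2 := Nat.ceil_lt_add_one (a := a / ((p : ℝ) * T₂)) (by positivity)
  set M := ⌈a / ((p : ℝ) * T₂)⌉₊
  rw [div_le_iff₀ hP] at c1
  have c3 := mul_lt_mul_of_pos_right c2 hP
  rw [add_mul, div_mul_cancel₀ _ hP.ne'] at c3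
  have hj' : (j : ℝ) ≤ J := by exact_mod_cast hj
  have hj2 := mul_le_mul_of_nonneg_right hj' hP.le
  have hj3 : 0 ≤ (j : ℝ) * (p * T₂) := by positivity
  have e : (((M + 1 + j) * p : ℕ) : ℝ) * T₂ = M * (p * T₂) + p * T₂ + j * (p * T₂) := by
    push_cast; ring
  refine ⟨(M + 1 + j) * p, m + (M + 1 + j) * q, ⟨?_, ?_⟩, ?_, ?_⟩
  · rw [e]; linarith
  · rw [e]; linarith
  · rw [e]; positivity
  · refine lt_of_le_of_lt (le_of_eq_of_le ?_ hm) hβ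
    congr 1
    push_cast; ring

lemma aux_inf (n : ℕ) (lam : ℝ) (hlam : 0 < lam) (ω : Fin n → ℝ)
    (r : Fin n → ℤ) (T : ℝ)
    (hrT : (∑ i, (r i : ℝ) * ω i) * T = 1)
    (S : Set (Fin n → ℝ))
    (hS : S = {x₀ | ∃ m : ℤ, ∑ i, (r i : ℝ) * x₀ i = (m : ℝ)})
    (w : (Fin n → ℝ) → (Fin n → ℝ) → ℝ → ℝ)
    (hw : ∀ x₀ x t, w x₀ x t
      = ∑ i, ⨅ j : ℤ, (lam / 4) * (x i - x₀ i + (j : ℝ) - ω i * t) ^ 2)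
    (x : Fin n → ℝ) :
    (∀ t (k : ℤ), sInf {v : ℝ | ∃ x₀ ∈ S, v = w x₀ x (t + k * T)}
      = sInf {v : ℝ | ∃ x₀ ∈ S, v = w x₀ x t}) ∧
    (∀ t d, sInf {v : ℝ | ∃ x₀ ∈ S, v = w x₀ x (t + d)}
      ≤ sInf {v : ℝ | ∃ x₀ ∈ S, v = w x₀ x t} + ∑ i, lam / 4 * (|ω i * d| + (ω i * d) ^ 2)) := by
  constructor
  · intro t k
    have key : ∀ (t : ℝ) (k : ℤ), {v : ℝ | ∃ x₀ ∈ S, v = w x₀ x t} ⊆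
        {v : ℝ | ∃ x₀ ∈ S, v = w x₀ x (t + k * T)} := by
      rintro t k v ⟨x₀, h, rfl⟩
      rw [hS] at h
      obtain ⟨m, hm⟩ := h
      refine ⟨fun i => x₀ i - ω i * (k * T), ?_, ?_⟩
      · rw [hS]
        refine ⟨m - k, ?_⟩
        have : ∑ i, (r i : ℝ) * (x₀ i - ω i * (k * T))
            = ∑ i, (r i : ℝ) * x₀ i - k * ((∑ i, (r i : ℝ) * ω i) * T) := by
          rw [Finset.sum_mul, Finset.mul_sum, ← Finset.sum_sub_distrib]
          exact Finset.sum_congr rfl fun i _ => by ring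
        rw [this, hm, hrT]; push_cast; ring
      · rw [hw, hw]
        refine Finset.sum_congr rfl fun i _ => ?_
        congr 1; ext j; ring
    congr 1
    refine Set.Subset.antisymm ?_ (key t k)
    have := key (t + k * T) (-k)
    have e : t + k * T + ((-k : ℤ) : ℝ) * T = t := by push_cast; ring
    rwa [e] at this
  · intro t d
    have hne : {v : ℝ | ∃ x₀ ∈ S, v = w x₀ x t}.Nonempty :=
      ⟨_, 0, by rw [hS]; exact ⟨0, by simp⟩, rfl⟩
    rw [← sub_le_iff_le_add]
    refine le_csInf hne ?_
    rintro _ ⟨x₀, h, rfl⟩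
    rw [sub_le_iff_le_add]
    refine le_trans (csInf_le ⟨0, ?_⟩ ⟨x₀, h, rfl⟩) ?_
    · rintro _ ⟨y, -, rfl⟩
      rw [hw]
      exact Finset.sum_nonneg fun i _ => Real.iInf_nonneg fun j => by positivity
    · rw [hw, hw, ← Finset.sum_add_distrib]
      refine Finset.sum_le_sum fun i _ => ?_
      have := aux_phi_le (lam / 4) (x i - x₀ i - ω i * t) (-(ω i * d)) (by positivity)
      rw [abs_neg, neg_sq] at this
      have e1 : ∀ j : ℤ, x i - x₀ i - ω i * t + -(ω i * d) + (j : ℝ)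
          = x i - x₀ i + (j : ℝ) - ω i * (t + d) := fun j => by ring
      have e2 : ∀ j : ℤ, x i - x₀ i - ω i * t + (j : ℝ)
          = x i - x₀ i + (j : ℝ) - ω i * t := fun j => by ring
      simp only [e1, e2] at this
      exact this

/-- With `w_{x₀}` as in the example, `(r·ω)·T₁ = 1`, `(s·ω)·T₂ = 1`, and
`ũ(x,t) := min{ inf_{x₀ ∈ S_r} w_{x₀}(x,t), inf_{x₀ ∈ S_s} w_{x₀}(x,t) }`, for every fixed
`x` the function `t ↦ ũ(x,t)` is Bohr almost periodic: for every `ε > 0` its set of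
`ε`-periods is relatively dense in `[0,+∞)`. -/
theorem stmt_17 (n : ℕ) (lam : ℝ) (hlam : 0 < lam) (ω : Fin n → ℝ)
    (r s : Fin n → ℤ) (T₁ T₂ : ℝ) (hT₁ : 0 < T₁) (hT₂ : 0 < T₂)
    (hrT : (∑ i, (r i : ℝ) * ω i) * T₁ = 1) (hsT : (∑ i, (s i : ℝ) * ω i) * T₂ = 1)
    (Sr Ss : Set (Fin n → ℝ))
    (hSr : Sr = {x₀ | ∃ m : ℤ, ∑ i, (r i : ℝ) * x₀ i = (m : ℝ)})
    (hSs : Ss = {x₀ | ∃ m : ℤ, ∑ i, (s i : ℝ) * x₀ i = (m : ℝ)})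
    (w : (Fin n → ℝ) → (Fin n → ℝ) → ℝ → ℝ)
    (hw : ∀ x₀ x t, w x₀ x t
      = ∑ i, ⨅ j : ℤ, (lam / 4) * (x i - x₀ i + (j : ℝ) - ω i * t) ^ 2)
    (util : (Fin n → ℝ) → ℝ → ℝ)
    (hutil : ∀ x t, util x t
      = min (sInf {v : ℝ | ∃ x₀ ∈ Sr, v = w x₀ x t})
            (sInf {v : ℝ | ∃ x₀ ∈ Ss, v = w x₀ x t}))
    (x : Fin n → ℝ) :
    ∀ ε > 0, ∃ L > 0, ∀ a : ℝ, 0 ≤ a → ∃ τ ∈ Set.Icc a (a + L), 0 < τ ∧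
      ∀ t : ℝ, |util x (t + τ) - util x t| ≤ ε := by
  intro ε hε
  obtain ⟨hf1, hf2⟩ := aux_inf n lam hlam ω r T₁ hrT Sr hSr w hw x
  obtain ⟨hg1, -⟩ := aux_inf n lam hlam ω s T₂ hsT Ss hSs w hw x
  have hC : Continuous fun d : ℝ => ∑ i, lam / 4 * (|ω i * d| + (ω i * d) ^ 2) := by fun_prop
  obtain ⟨δ, hδ, hδ'⟩ := Metric.continuous_iff.1 hC 0 ε hε
  have hsm : ∀ d : ℝ, |d| < δ → ∑ i, lam / 4 * (|ω i * d| + (ω i * d) ^ 2) ≤ ε := by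
    intro d hd
    have := hδ' d (by simpa using hd)
    simp only [Real.dist_eq, mul_zero, abs_zero, zero_pow two_ne_zero, add_zero,
      Finset.sum_const_zero, sub_zero] at this
    exact ((le_abs_self _).trans_lt this).le
  obtain ⟨L, hL, H⟩ := aux_dense T₁ T₂ hT₁ hT₂ δ hδ
  refine ⟨L, hL, fun a ha => ?_⟩
  obtain ⟨k, m, hk, hk0, hkm⟩ := H a ha
  refine ⟨k * T₂, hk, hk0, fun t => ?_⟩
  rw [hutil, hutil]
  have g1 := hg1 t k
  rw [Int.cast_natCast] at g1
  rw [g1]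
  refine (abs_min_sub_min_le_max _ _ _ _).trans (max_le ?_ (by simpa using hε.le))
  have f1 := hf1 (t + (k * T₂ - m * T₁)) m
  have e : t + (k * T₂ - m * T₁) + m * T₁ = t + k * T₂ := by ring
  rw [e] at f1
  rw [f1]
  set d := k * T₂ - m * T₁
  have h1 := hf2 t d
  have h2 := hf2 (t + d) (-d)
  rw [add_neg_cancel_right] at h2
  have h3 := hsm d hkm
  have h4 := hsm (-d) (by rwa [abs_neg])
  rw [abs_le]
  constructor <;> linarith
end
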